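/- Let G be a finite p-group acting on V over k of characteristic p, and let I = I^G_{<G} be the transfer ideal corresponding to the set of all proper subgroups of G. Then the quotient ring k[V]^G / I is Cohen–Macaulay of Krull dimension dim(V^G). -/

import Mathlib

open MvPolynomial

/-- The ring of `H`-invariants in `R`. -/
def invSub (G R : Type) [Group G] [CommRing R] [MulSemiringAction G R]
    (H : Subgroup G) : Subring R where
  carrier := {f : R | ∀ h : H, (h : G) • f = f}
  mul_mem' := fun ha hb h => by rw [smul_mul', ha h, hb h]
  one_mem' := fun h => smul_one _
  add_mem' := fun ha hb h => by rw [smul_add, ha h, hb h]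
  zero_mem' := fun h => smul_zero _
  neg_mem' := fun ha h => by rw [smul_neg, (ha h : _)]

/-- The relative transfer `Tr^H_K`, summing over representatives of `H/K`. -/
noncomputable def relTransfer (G R : Type) [Group G] [Finite G] [CommRing R]
    [MulSemiringAction G R] (H K : Subgroup G) (f : R) : R :=
  haveI : Fintype (H ⧸ K.subgroupOf H) := Fintype.ofFinite _
  ∑ c : H ⧸ K.subgroupOf H, ((Quotient.out c : H) : G) • f

/-- The transfer ideal `I^G_{<G} = Σ_{X < G} Tr^G_X(k[V]^X)` of `k[V]^G`,
for the family of all proper subgroups of `G`. -/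
noncomputable def transferIdealProper (G R : Type) [Group G] [Finite G] [CommRing R]
    [MulSemiringAction G R] : Ideal (invSub G R ⊤) :=
  Ideal.span {y | ∃ X : Subgroup G, X ≠ ⊤ ∧ ∃ f : R, (∀ x : X, (x : G) • f = f) ∧
    (y : R) = relTransfer G R ⊤ X f}

/-- The submodule of `Q`-fixed vectors of `V`. -/
def fixedSubmodule (k G V : Type) [Field k] [Group G] [AddCommGroup V] [Module k V]
    [DistribMulAction G V] [SMulCommClass G k V] (Q : Subgroup G) : Submodule k V where
  carrier := {v | ∀ g : Q, (g : G) • v = v}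
  add_mem' := fun ha hb g => by rw [smul_add, ha g, hb g]
  zero_mem' := fun g => smul_zero _
  smul_mem' := fun c v hv g => by rw [smul_comm, hv g]

theorem aux_krull_eq {A B : Type} [CommRing A] [CommRing B] [Algebra A B]
    [Algebra.IsIntegral A B]
    (hs : Function.Surjective (PrimeSpectrum.comap (algebraMap A B))) :
    ringKrullDim A = ringKrullDim B := by
  apply le_antisymm
  · refine iSup_le fun l => ?_
    obtain ⟨P, hP⟩ := hs l.head
    have : P.asIdeal.LiesOver l.head.asIdeal := ⟨by rw [← hP]; rfl⟩
    obtain ⟨L, hL, -⟩ := Ideal.exists_ltSeries_of_hasGoingUp (S := B) l P.asIdeal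
    rw [← hL]
    exact le_iSup (fun L : LTSeries (PrimeSpectrum B) => ((L.length : ℕ∞) : WithBot ℕ∞)) L
  · refine Order.krullDim_le_of_strictMono (PrimeSpectrum.comap (algebraMap A B)) ?_
    intro P Q h
    exact Ideal.IsIntegral.comap_lt_comap (R := A) (I := P.asIdeal) (J := Q.asIdeal) h

theorem aux_regular {S : Type} [CommRing S] (ρ : S →+* Polynomial S)
    (h0 : ∀ s, (ρ s).coeff 0 = s) (K : Ideal S)
    (hK : ∀ x ∈ K, ρ x ∈ K.map (Polynomial.C : S →+* Polynomial S))
    (y : S) (hy : (ρ y).Monic) (r : S) (hr : y * r ∈ K) : r ∈ K := by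
  have h1 := hK _ hr
  rw [Ideal.mem_map_C_iff] at h1
  have h2 : ((ρ y).map (Ideal.Quotient.mk K)) * ((ρ r).map (Ideal.Quotient.mk K)) = 0 := by
    rw [← Polynomial.map_mul, ← map_mul]
    ext n
    rw [Polynomial.coeff_map, Polynomial.coeff_zero]
    exact Ideal.Quotient.eq_zero_iff_mem.2 (h1 n)
  have h3 := (hy.map (Ideal.Quotient.mk K)).mul_right_eq_zero_iff.1 h2
  have h4 := congrArg (fun q => Polynomial.coeff q 0) h3
  simp only [Polynomial.coeff_map, Polynomial.coeff_zero, h0] at h4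
  exact Ideal.Quotient.eq_zero_iff_mem.1 h4

theorem aux_lift {R : Type} [CommRing R] (S : Subring R) (ρ : R →+* Polynomial R)
    (h : ∀ s ∈ S, ∀ n, (ρ s).coeff n ∈ S) :
    ∃ ρS : S →+* Polynomial S, ∀ s : S, (ρS s).map S.subtype = ρ s := by
  have hinj : Function.Injective (Polynomial.mapRingHom S.subtype) :=
    Polynomial.map_injective _ Subtype.val_injective
  have hr : ∀ s : S, ∃ q : Polynomial S, q.map S.subtype = ρ s := by
    intro s
    rw [← Polynomial.mem_lifts, Polynomial.lifts_iff_coeff_lifts]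
    intro n
    exact ⟨⟨_, h s s.2 n⟩, rfl⟩
  choose F hF using hr
  refine ⟨⟨⟨⟨F, ?_⟩, ?_⟩, ?_, ?_⟩, hF⟩
  · apply hinj; simp [hF]
  · intro a b; apply hinj; simp [hF]
  · apply hinj; simp [hF]
  · intro a b; apply hinj; simp [hF]

theorem aux_prime {G R : Type} [Group G] [Fintype G] [CommRing R] [MulSemiringAction G R]
    (Q : Ideal R) [Q.IsPrime]
    (hQ : ∀ X : Subgroup G, X ≠ ⊤ → ∀ f : R, (∀ x : X, (x : G) • f = f) →
      relTransfer G R ⊤ X f ∈ Q) (g : G) (f : R) : g • f - f ∈ Q := by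
  classical
  let X : Subgroup G :=
    { carrier := {g | ∀ f : R, g • f - f ∈ Q}
      mul_mem' := by
        intro a b ha hb f
        have := Q.add_mem (ha (b • f)) (hb f)
        simpa [mul_smul] using this
      one_mem' := by intro f; simp
      inv_mem' := by
        intro a ha f
        have := Q.neg_mem (ha (a⁻¹ • f))
        simpa using this }
  by_cases hX : X = ⊤
  · have : g ∈ X := hX ▸ Subgroup.mem_top g
    exact this f
  exfalso
  let _ : Fintype ((⊤ : Subgroup G) ⧸ X.subgroupOf ⊤) := Fintype.ofFinite _
  let χ : (⊤ : Subgroup G) ⧸ X.subgroupOf ⊤ → (invSub G R X →* R ⧸ Q) := fun c =>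
    { toFun := fun f => Ideal.Quotient.mk Q (((Quotient.out c : (⊤ : Subgroup G)) : G) • (f : R))
      map_one' := by simp
      map_mul' := by intro a b; simp [smul_mul'] }
  have hsum : ∀ f : invSub G R X, ∑ c, χ c f = 0 := by
    intro f
    have := hQ X hX f f.2
    rw [← Ideal.Quotient.eq_zero_iff_mem] at this
    simpa [relTransfer, χ] using this
  let c0 : (⊤ : Subgroup G) ⧸ X.subgroupOf ⊤ := QuotientGroup.mk 1
  have key : ∀ c, χ c = χ c0 → c = c0 := by
    intro c hc
    -- the representative of `c0` lies in `X`
    have h0 : ((Quotient.out c0 : (⊤ : Subgroup G)) : G) ∈ X := by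
      have h1 : (QuotientGroup.mk (Quotient.out c0) : (⊤ : Subgroup G) ⧸ X.subgroupOf ⊤)
        = QuotientGroup.mk 1 := Quotient.out_eq c0
      have h2 := QuotientGroup.eq.1 h1
      rw [Subgroup.mem_subgroupOf] at h2
      simpa using h2
    have hcX : ((Quotient.out c : (⊤ : Subgroup G)) : G) ∈ X := by
      intro f
      set g : G := ((Quotient.out c : (⊤ : Subgroup G)) : G) with hg
      -- the polynomial with roots `x • f`
      let P : Polynomial R := ∏ x : X, (Polynomial.X - Polynomial.C ((x : G) • f))
      have hPinv : ∀ y : X, ∀ n, (y : G) • P.coeff n = P.coeff n := by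
        intro y n
        have : Polynomial.map (MulSemiringAction.toRingHom G R (y : G)) P = P := by
          simp only [P, Polynomial.map_prod, Polynomial.map_sub, Polynomial.map_X,
            Polynomial.map_C, MulSemiringAction.toRingHom_apply]
          refine Fintype.prod_equiv (Equiv.mulLeft y) _ _ ?_
          intro x
          simp [mul_smul]
        conv_rhs => rw [← this]
        rw [Polynomial.coeff_map]; rfl
      have hmap : (P.map (MulSemiringAction.toRingHom G R g)).map (Ideal.Quotient.mk Q) =
          P.map (Ideal.Quotient.mk Q) := by
        ext n
        have h1 := DFunLike.congr_fun hc ⟨P.coeff n, fun y => hPinv y n⟩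
        simp only [χ, MonoidHom.coe_mk, OneHom.coe_mk] at h1
        rw [Polynomial.coeff_map, Polynomial.coeff_map, Polynomial.coeff_map]
        have h2 : Ideal.Quotient.mk Q (((Quotient.out c0 : (⊤ : Subgroup G)) : G) • P.coeff n)
            = Ideal.Quotient.mk Q (P.coeff n) := Ideal.Quotient.eq.2 (h0 _)
        exact h1.trans h2
      have hev := congrArg (Polynomial.eval (Ideal.Quotient.mk Q (g • f))) hmap
      simp only [P, Polynomial.map_prod, Polynomial.map_sub, Polynomial.map_X, Polynomial.map_C,
        Polynomial.eval_prod, Polynomial.eval_sub, Polynomial.eval_X, Polynomial.eval_C,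
        MulSemiringAction.toRingHom_apply] at hev
      rw [Finset.prod_eq_zero (Finset.mem_univ (1 : X)) (by simp)] at hev
      obtain ⟨x, -, hx⟩ := Finset.prod_eq_zero_iff.1 hev.symm
      have hx2 : Ideal.Quotient.mk Q ((x : G) • f) = Ideal.Quotient.mk Q f :=
        Ideal.Quotient.eq.2 (x.2 f)
      rw [hx2, ← map_sub] at hx
      exact Ideal.Quotient.eq_zero_iff_mem.1 hx
    rw [← Quotient.out_eq c]
    refine QuotientGroup.eq.2 ?_
    rw [Subgroup.mem_subgroupOf]
    simpa using hcX
  have hli := linearIndependent_monoidHom (invSub G R X) (R ⧸ Q)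
  rw [linearIndependent_iff] at hli
  have hl := hli (∑ c, Finsupp.single (χ c) 1) (by
    ext f
    simp only [map_sum, Finsupp.linearCombination_single, one_smul, Finset.sum_apply]
    exact hsum f)
  have hl0 := DFunLike.congr_fun hl (χ c0)
  rw [Finsupp.finsetSum_apply, Finset.sum_eq_single c0] at hl0
  · simp at hl0
  · intro c _ hc
    exact Finsupp.single_eq_of_ne (fun h => hc (key c h.symm))
  · simp

theorem aux_hom_one {k : Type} [Field k] {n : ℕ} {ℓ : MvPolynomial (Fin n) k}
    (h : ℓ.IsHomogeneous 1) {P : MvPolynomial (Fin n) k → Prop}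
    (hX : ∀ i, P (X i)) (h0 : P 0) (hadd : ∀ a b, P a → P b → P (a + b))
    (hsmul : ∀ (c : k) a, P a → P (c • a)) : P ℓ := by
  have h1 : ℓ ∈ Submodule.span k (Set.range (X : Fin n → MvPolynomial (Fin n) k)) := by
    rw [← homogeneousSubmodule_one_eq_span_X]
    exact (mem_homogeneousSubmodule 1 ℓ).2 h
  induction h1 using Submodule.span_induction with
  | mem x hx => obtain ⟨i, rfl⟩ := hx; exact hX i
  | zero => exact h0
  | add x y hx hy ihx ihy =>
    exact hadd _ _ (ihx ((mem_homogeneousSubmodule 1 x).1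
      (homogeneousSubmodule_one_eq_span_X (R := k) (σ := Fin n) ▸ hx)))
      (ihy ((mem_homogeneousSubmodule 1 y).1
      (homogeneousSubmodule_one_eq_span_X (R := k) (σ := Fin n) ▸ hy)))
  | smul c x hx ihx =>
    exact hsmul _ _ (ihx ((mem_homogeneousSubmodule 1 x).1
      (homogeneousSubmodule_one_eq_span_X (R := k) (σ := Fin n) ▸ hx)))

/-- translation by `t v`. -/
noncomputable def auxTrans {k : Type} [Field k] {n : ℕ} (v : Fin n → k) :
    MvPolynomial (Fin n) k →ₐ[k] Polynomial (MvPolynomial (Fin n) k) :=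
  aeval fun i => Polynomial.C (X i) + Polynomial.C (C (v i)) * Polynomial.X

theorem auxTrans_lin {k : Type} [Field k] {n : ℕ} (v : Fin n → k)
    {ℓ : MvPolynomial (Fin n) k} (h : ℓ.IsHomogeneous 1) :
    auxTrans v ℓ = Polynomial.C ℓ + Polynomial.C (C (eval v ℓ)) * Polynomial.X := by
  refine aux_hom_one h (P := fun ℓ => auxTrans v ℓ =
    Polynomial.C ℓ + Polynomial.C (C (eval v ℓ)) * Polynomial.X) ?_ ?_ ?_ ?_
  · intro i; simp [auxTrans]
  · simp
  · intro a b ha hb; rw [map_add, ha, hb]; simp only [map_add]; ring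
  · intro c a ha
    rw [map_smul, ha, smul_add, smul_eval, C_mul, Polynomial.C_mul, mul_assoc,
      Polynomial.smul_C]
    congr 1
    rw [Algebra.smul_def]; rfl

/-- restriction to the span of the `b j`. -/
noncomputable def auxRestr {k : Type} [Field k] {n d : ℕ} (b : Fin d → Fin n → k) :
    MvPolynomial (Fin n) k →ₐ[k] MvPolynomial (Fin d) k :=
  aeval fun i => ∑ j, C (b j i) * X j

theorem auxRestr_lin {k : Type} [Field k] {n d : ℕ} (b : Fin d → Fin n → k)
    {ℓ : MvPolynomial (Fin n) k} (h : ℓ.IsHomogeneous 1) :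
    auxRestr b ℓ = ∑ j, C (eval (b j) ℓ) * X j := by
  refine aux_hom_one h (P := fun ℓ => auxRestr b ℓ = ∑ j, C (eval (b j) ℓ) * X j) ?_ ?_ ?_ ?_
  · intro i; simp [auxRestr]
  · simp
  · intro a b ha hb; rw [map_add, ha, hb]; simp only [map_add, add_mul, Finset.sum_add_distrib]
  · intro c a ha
    rw [map_smul, ha, Finset.smul_sum]
    refine Finset.sum_congr rfl fun j _ => ?_
    rw [smul_eval, C_mul, mul_assoc, smul_eq_C_mul]

theorem auxTrans_coeff_zero {k : Type} [Field k] {n : ℕ} (v : Fin n → k)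
    (f : MvPolynomial (Fin n) k) : (auxTrans v f).coeff 0 = f := by
  have : (Polynomial.constantCoeff.comp (auxTrans v).toRingHom) =
      RingHom.id (MvPolynomial (Fin n) k) := by
    apply MvPolynomial.ringHom_ext
    · intro c
      have : auxTrans v (C c) = Polynomial.C (C c) := (auxTrans v).commutes c
      simp [this]
    · intro i
      simp [auxTrans]
  exact RingHom.congr_fun this f

section
variable {k : Type} [Field k] {G : Type} [Group G] [Fintype G] {n : ℕ}
    [MulSemiringAction G (MvPolynomial (Fin n) k)]
    [SMulCommClass G k (MvPolynomial (Fin n) k)]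

theorem aux_smul_C (σ : G) (c : k) : σ • (C c : MvPolynomial (Fin n) k) = C c :=
  (MulSemiringAction.toAlgHom k (MvPolynomial (Fin n) k) σ).commutes c

theorem auxTrans_smul (hlin : ∀ (σ : G) (i : Fin n),
      (σ • (X i : MvPolynomial (Fin n) k)).IsHomogeneous 1)
    (v : Fin n → k) (hv : ∀ (σ : G) i, eval v (σ • (X i : MvPolynomial (Fin n) k)) = v i)
    (σ : G) (f : MvPolynomial (Fin n) k) :
    auxTrans v (σ • f) = (auxTrans v f).map
      (MulSemiringAction.toRingHom G (MvPolynomial (Fin n) k) σ) := by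
  have : ((auxTrans v).toRingHom.comp (MulSemiringAction.toRingHom G _ σ)) =
      (Polynomial.mapRingHom (MulSemiringAction.toRingHom G (MvPolynomial (Fin n) k) σ)).comp
        (auxTrans v).toRingHom := by
    apply MvPolynomial.ringHom_ext
    · intro c
      have h : auxTrans v (C c) = Polynomial.C (C c) := (auxTrans v).commutes c
      simp [h, aux_smul_C]
    · intro i
      have h1 := auxTrans_lin v (hlin σ i)
      have h2 : auxTrans v (X i) = Polynomial.C (X i) + Polynomial.C (C (v i)) * Polynomial.X := by
        simp [auxTrans]
      simp [h1, h2, hv, aux_smul_C]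
  exact RingHom.congr_fun this f

theorem auxRestr_smul {d : ℕ} (hlin : ∀ (σ : G) (i : Fin n),
      (σ • (X i : MvPolynomial (Fin n) k)).IsHomogeneous 1)
    (b : Fin d → Fin n → k)
    (hv : ∀ j (σ : G) i, eval (b j) (σ • (X i : MvPolynomial (Fin n) k)) = b j i)
    (σ : G) (f : MvPolynomial (Fin n) k) :
    auxRestr b (σ • f) = auxRestr b f := by
  have : ((auxRestr b).toRingHom.comp (MulSemiringAction.toRingHom G _ σ)) =
        (auxRestr b).toRingHom := by
    apply MvPolynomial.ringHom_ext
    · intro c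
      simp [aux_smul_C]
    · intro i
      have h1 := auxRestr_lin b (hlin σ i)
      have h2 := auxRestr_lin b (isHomogeneous_X k i)
      simp [h1, h2, hv]
  exact RingHom.congr_fun this f

theorem aux_smul_lin (hlin : ∀ (σ : G) (i : Fin n),
      (σ • (X i : MvPolynomial (Fin n) k)).IsHomogeneous 1) (σ : G)
    {ℓ : MvPolynomial (Fin n) k} (h : ℓ.IsHomogeneous 1) : (σ • ℓ).IsHomogeneous 1 := by
  refine aux_hom_one h (P := fun ℓ => (σ • ℓ).IsHomogeneous 1) (hlin σ) ?_ ?_ ?_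
  · simpa using isHomogeneous_zero _ _ _
  · intro a b ha hb; rw [smul_add]; exact ha.add hb
  · intro c a ha; rw [smul_comm, smul_eq_C_mul]; simpa using (isHomogeneous_C _ c).mul ha

theorem aux_restr_transfer (p : ℕ) [Fact p.Prime] [CharP k p] (hG : IsPGroup p G) {d : ℕ}
    (hlin : ∀ (σ : G) (i : Fin n),
      (σ • (X i : MvPolynomial (Fin n) k)).IsHomogeneous 1)
    (b : Fin d → Fin n → k)
    (hv : ∀ j (σ : G) i, eval (b j) (σ • (X i : MvPolynomial (Fin n) k)) = b j i)
    (Y : Subgroup G) (hY : Y ≠ ⊤) (f : MvPolynomial (Fin n) k) :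
    auxRestr b (relTransfer G _ ⊤ Y f) = 0 := by
  unfold relTransfer
  rw [map_sum]
  simp only [auxRestr_smul hlin b hv, Finset.sum_const, Finset.card_univ]
  have hp : p ∣ @Fintype.card ((⊤ : Subgroup G) ⧸ Y.subgroupOf ⊤) (Fintype.ofFinite _) := by
    rw [← @Nat.card_eq_fintype_card _ (Fintype.ofFinite _)]
    change p ∣ Y.relIndex ⊤
    rw [Subgroup.relIndex_top_right]
    obtain ⟨m, hm⟩ := hG.index Y
    rw [hm]
    refine dvd_pow_self p ?_
    rintro rfl
    exact hY (Subgroup.index_eq_one.1 (by simpa using hm))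
  rw [nsmul_eq_mul, (CharP.cast_eq_zero_iff (MvPolynomial (Fin d) k) p _).2 hp, zero_mul]

theorem aux_trans_transfer
    (hlin : ∀ (σ : G) (i : Fin n),
      (σ • (X i : MvPolynomial (Fin n) k)).IsHomogeneous 1)
    (v : Fin n → k) (hv : ∀ (σ : G) i, eval v (σ • (X i : MvPolynomial (Fin n) k)) = v i)
    (Y : Subgroup G) (f : MvPolynomial (Fin n) k) (m : ℕ) :
    (auxTrans v (relTransfer G _ ⊤ Y f)).coeff m = relTransfer G _ ⊤ Y ((auxTrans v f).coeff m) := by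
  unfold relTransfer
  rw [map_sum, Polynomial.finsetSum_coeff]
  simp only [auxTrans_smul hlin v hv, Polynomial.coeff_map, MulSemiringAction.toRingHom_apply]

end

theorem aux_transfer_mem {G R : Type} [Group G] [Fintype G] [CommRing R] [MulSemiringAction G R]
    (Y : Subgroup G) (f : R) (hf : ∀ x : Y, (x : G) • f = f) :
    relTransfer G R ⊤ Y f ∈ invSub G R ⊤ := by
  intro g
  have hrep : ∀ (a a2 : (⊤ : Subgroup G)),
      (QuotientGroup.mk a : (⊤ : Subgroup G) ⧸ Y.subgroupOf ⊤) = QuotientGroup.mk a2 →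
      (a : G) • f = (a2 : G) • f := by
    intro a a2 h
    have h2 := QuotientGroup.eq.1 h
    rw [Subgroup.mem_subgroupOf] at h2
    have h3 := hf ⟨_, h2⟩
    have h4 := congrArg (fun u => (a : G) • u) h3
    simp only [← mul_smul] at h4
    rw [← h4]
    simp
  unfold relTransfer
  rw [Finset.smul_sum]
  refine @Fintype.sum_equiv _ _ _ (Fintype.ofFinite _) (Fintype.ofFinite _) _
    (MulAction.toPerm (β := (⊤ : Subgroup G) ⧸ Y.subgroupOf ⊤) g) _ _ ?_
  intro c
  rw [← mul_smul]
  refine hrep (g * Quotient.out c) _ ?_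
  have h1 : (QuotientGroup.mk (Quotient.out (MulAction.toPerm (β := (⊤ : Subgroup G) ⧸ Y.subgroupOf ⊤) g c)) :
      (⊤ : Subgroup G) ⧸ Y.subgroupOf ⊤) = MulAction.toPerm (β := (⊤ : Subgroup G) ⧸ Y.subgroupOf ⊤) g c := Quotient.out_eq _
  rw [h1]
  have h2 : (QuotientGroup.mk (Quotient.out c) :
      (⊤ : Subgroup G) ⧸ Y.subgroupOf ⊤) = c := Quotient.out_eq _
  conv_rhs => rw [← h2]
  rfl

section
variable {k : Type} [Field k] {G : Type} [Group G] [Fintype G] {n : ℕ}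
    [MulSemiringAction G (MvPolynomial (Fin n) k)]
    [SMulCommClass G k (MvPolynomial (Fin n) k)]

theorem aux_dim (p : ℕ) [Fact p.Prime] [CharP k p] (hG : IsPGroup p G) {d : ℕ}
    (hlin : ∀ (σ : G) (i : Fin n),
      (σ • (X i : MvPolynomial (Fin n) k)).IsHomogeneous 1)
    (b : Fin d → Fin n → k)
    (hv : ∀ j (σ : G) i, eval (b j) (σ • (X i : MvPolynomial (Fin n) k)) = b j i)
    (ℓ : Fin d → MvPolynomial (Fin n) k) (hℓ : ∀ j, (ℓ j).IsHomogeneous 1)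
    (hℓb : ∀ i j, eval (b i) (ℓ j) = if i = j then 1 else 0)
    (hgen : ∀ i, (X i - ∑ j, C (b j i) * ℓ j : MvPolynomial (Fin n) k) ∈
      Submodule.span k (Set.range fun q : G × Fin n =>
        (q.1 • (X q.2 : MvPolynomial (Fin n) k) - X q.2))) :
    ringKrullDim ((invSub G (MvPolynomial (Fin n) k) ⊤) ⧸
        transferIdealProper G (MvPolynomial (Fin n) k)) = (d : WithBot (WithTop ℕ)) := by
  set S := invSub G (MvPolynomial (Fin n) k) ⊤ with hS
  set I := transferIdealProper G (MvPolynomial (Fin n) k) with hI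
  let π : (MvPolynomial (Fin n) k) →+* MvPolynomial (Fin d) k := (auxRestr b).toRingHom
  have hπs : ∀ f, π (aeval ℓ f) = f := by
    intro f
    have : (auxRestr b).comp (aeval ℓ) = AlgHom.id k _ := by
      ext j : 1
      simp [auxRestr_lin b (hℓ j), hℓb]
    exact DFunLike.congr_fun this f
  have hπ : Function.Surjective π := fun f => ⟨_, hπs f⟩
  have hIle : ∀ a ∈ I, π.comp S.subtype a = 0 := by
    intro a ha
    have : I ≤ RingHom.ker (π.comp S.subtype) := by
      refine Ideal.span_le.2 ?_
      rintro y ⟨Y, hY, f, hf, hy⟩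
      rw [SetLike.mem_coe, RingHom.mem_ker]
      change π (y : (MvPolynomial (Fin n) k)) = 0
      rw [hy]
      exact aux_restr_transfer p hG hlin b hv Y hY f
    exact this ha
  let θ : S ⧸ I →+* MvPolynomial (Fin d) k := Ideal.Quotient.lift I (π.comp S.subtype) hIle
  have hinv : Algebra.IsInvariant S (MvPolynomial (Fin n) k) G := ⟨fun f hf => ⟨⟨f, fun h => hf h⟩, rfl⟩⟩
  have hint : Algebra.IsIntegral S (MvPolynomial (Fin n) k) := Algebra.IsInvariant.isIntegral S (MvPolynomial (Fin n) k) G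
  have hint2 : (S.subtype).IsIntegral := fun x => hint.isIntegral x
  have hθ : θ.IsIntegral := by
    have h1 : (π.comp S.subtype).IsIntegral := hint2.trans _ _ (π.isIntegral_of_surjective hπ)
    have h2 : (θ.comp (Ideal.Quotient.mk I)).IsIntegral := by
      convert h1
      exact Ideal.Quotient.lift_comp_mk I _ hIle
    exact RingHom.IsIntegral.tower_top _ _ h2
  have hsurj : Function.Surjective (PrimeSpectrum.comap θ) := by
    intro P
    let P2 : Ideal S := P.asIdeal.comap (Ideal.Quotient.mk I)
    obtain ⟨Q, -, hQ, hQP⟩ := Ideal.exists_ideal_over_prime_of_isIntegral (S := (MvPolynomial (Fin n) k)) P2 ⊥ (by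
      intro x hx
      have : x = 0 := Subtype.ext (by simpa using hx)
      rw [this]; exact P2.zero_mem)
    have hQ1 : ∀ s : S, (s : (MvPolynomial (Fin n) k)) ∈ Q ↔ Ideal.Quotient.mk I s ∈ P.asIdeal := by
      intro s
      have : s ∈ Q.comap (algebraMap S (MvPolynomial (Fin n) k)) ↔ s ∈ P2 := by rw [hQP]
      exact this
    have hinert := aux_prime (G := G) Q (by
      intro Y hY f hf
      have hmem : relTransfer G (MvPolynomial (Fin n) k) ⊤ Y f ∈ S := by
        exact aux_transfer_mem Y f hf
      have hmemI : (⟨_, hmem⟩ : S) ∈ I := Ideal.subset_span ⟨Y, hY, f, hf, rfl⟩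
      refine (hQ1 ⟨_, hmem⟩).2 ?_
      rw [Ideal.Quotient.eq_zero_iff_mem.2 hmemI]
      exact P.asIdeal.zero_mem)
    have hX : ∀ i, (X i - ∑ j, C (b j i) * ℓ j : (MvPolynomial (Fin n) k)) ∈ Q := by
      intro i
      have : Submodule.span k (Set.range fun q : G × Fin n =>
        (q.1 • (X q.2 : MvPolynomial (Fin n) k) - X q.2)) ≤ Q.restrictScalars k := by
        refine Submodule.span_le.2 ?_
        rintro _ ⟨q, rfl⟩
        exact hinert q.1 (X q.2)
      exact this (hgen i)
    have hker : RingHom.ker π ≤ Q := by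
      have h1 : ∀ f : (MvPolynomial (Fin n) k), Ideal.Quotient.mk Q f = Ideal.Quotient.mk Q (aeval ℓ (π f)) := by
        intro f
        have : (Ideal.Quotient.mkₐ k Q) = (Ideal.Quotient.mkₐ k Q).comp
            ((aeval ℓ).comp (auxRestr b)) := by
          ext i : 1
          have h2 : aeval ℓ (auxRestr b (X i)) = ∑ j, C (b j i) * ℓ j := by
            simp [auxRestr, algebraMap_eq]
          simp only [AlgHom.comp_apply, h2]
          exact Ideal.Quotient.eq.2 (hX i)
        exact DFunLike.congr_fun this f
      intro f hf
      rw [← Ideal.Quotient.eq_zero_iff_mem, h1 f, (RingHom.mem_ker).1 hf, map_zero, map_zero]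
    have hprime : (Q.map π).IsPrime := Ideal.map_isPrime_of_surjective hπ hker
    refine ⟨⟨Q.map π, hprime⟩, ?_⟩
    ext a
    obtain ⟨s, rfl⟩ := Ideal.Quotient.mk_surjective a
    change π (s : (MvPolynomial (Fin n) k)) ∈ Q.map π ↔ _
    rw [← hQ1, ← Ideal.mem_comap, Ideal.comap_map_of_surjective' π hπ, sup_eq_left.2 hker]
  let _ : Algebra (S ⧸ I) (MvPolynomial (Fin d) k) := θ.toAlgebra
  have : Algebra.IsIntegral (S ⧸ I) (MvPolynomial (Fin d) k) := ⟨hθ⟩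
  rw [aux_krull_eq (B := MvPolynomial (Fin d) k) hsurj,
    MvPolynomial.ringKrullDim_of_isNoetherianRing, ringKrullDim_eq_zero_of_field, zero_add,
    Nat.card_eq_fintype_card, Fintype.card_fin]
  rfl

theorem aux_seq {d : ℕ}
    (hlin : ∀ (σ : G) (i : Fin n),
      (σ • (X i : MvPolynomial (Fin n) k)).IsHomogeneous 1)
    (b : Fin d → Fin n → k)
    (hv : ∀ j (σ : G) i, eval (b j) (σ • (X i : MvPolynomial (Fin n) k)) = b j i)
    (ℓ : Fin d → MvPolynomial (Fin n) k) (hℓ : ∀ j, (ℓ j).IsHomogeneous 1)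
    (hℓb : ∀ i j, eval (b i) (ℓ j) = if i = j then 1 else 0) :
    ∃ a : Fin d → (invSub G (MvPolynomial (Fin n) k) ⊤) ⧸
          transferIdealProper G (MvPolynomial (Fin n) k),
      (∀ i, ∃ f : invSub G (MvPolynomial (Fin n) k) ⊤,
        constantCoeff (f : MvPolynomial (Fin n) k) = 0 ∧
        a i = Ideal.Quotient.mk (transferIdealProper G (MvPolynomial (Fin n) k)) f) ∧
      (∀ j, ∀ r, a j * r ∈ Ideal.span {y | ∃ i, i < j ∧ y = a i} →
        r ∈ Ideal.span {y | ∃ i, i < j ∧ y = a i}) := by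
  set S := invSub G (MvPolynomial (Fin n) k) ⊤ with hS
  set I := transferIdealProper G (MvPolynomial (Fin n) k) with hI
  have hyS : ∀ j, (∏ σ : G, σ • ℓ j) ∈ S := by
    intro j h
    rw [Finset.smul_prod']
    refine Fintype.prod_equiv (Equiv.mulLeft (h : G)) _ _ ?_
    intro x
    simp [mul_smul]
  let y : Fin d → S := fun j => ⟨_, hyS j⟩
  have hev : ∀ (i j) (σ : G), eval (b i) (σ • ℓ j) = if i = j then 1 else 0 := by
    intro i j σ
    rw [← hℓb i j]
    refine aux_hom_one (hℓ j) (P := fun ℓ => eval (b i) (σ • ℓ) = eval (b i) ℓ) ?_ ?_ ?_ ?_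
    · intro m; simp [hv]
    · simp
    · intro u w hu hw; simp [hu, hw]
    · intro c u hu; rw [smul_comm, smul_eval, smul_eval, hu]
  have hρy : ∀ i j, auxTrans (b i) (y j : (MvPolynomial (Fin n) k)) = ∏ σ : G, (Polynomial.C (σ • ℓ j) +
      Polynomial.C (C (if i = j then 1 else 0)) * Polynomial.X) := by
    intro i j
    change auxTrans (b i) (∏ σ : G, σ • ℓ j) = _
    rw [map_prod]
    refine Finset.prod_congr rfl fun σ _ => ?_
    rw [auxTrans_lin (b i) (aux_smul_lin hlin σ (hℓ j)), hev]
  refine ⟨fun j => Ideal.Quotient.mk I (y j), ?_, ?_⟩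
  · intro i
    refine ⟨y i, ?_, rfl⟩
    change constantCoeff (∏ σ : G, σ • ℓ i) = 0
    rw [map_prod]
    refine Finset.prod_eq_zero (Finset.mem_univ 1) ?_
    rw [one_smul]
    exact (hℓ i).coeff_eq_zero (by simp)
  · intro j r hr
    obtain ⟨r, rfl⟩ := Ideal.Quotient.mk_surjective r
    obtain ⟨ρ, hρ⟩ := aux_lift S (auxTrans (b j)).toRingHom (by
      intro s hs m σ
      have h1 := auxTrans_smul hlin (b j) (hv j) (σ : G) s
      rw [hs σ] at h1
      have h2 := congrArg (fun q => Polynomial.coeff q m) h1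
      simp only [Polynomial.coeff_map] at h2
      exact h2.symm)
    have hρ2 : ∀ s : S, ∀ m, (((ρ s).coeff m : S) : (MvPolynomial (Fin n) k)) = (auxTrans (b j) (s : (MvPolynomial (Fin n) k))).coeff m := by
      intro s m
      have := congrArg (fun q => Polynomial.coeff q m) (hρ s)
      simp only [Polynomial.coeff_map] at this
      exact this
    have hinj : Function.Injective (Polynomial.map S.subtype) :=
      Polynomial.map_injective _ Subtype.val_injective
    let K0 : Ideal S := Ideal.span {x | ∃ i, i < j ∧ x = y i}
    let K : Ideal S := K0 ⊔ I
    have hspan : Ideal.span {z | ∃ i, i < j ∧ z = Ideal.Quotient.mk I (y i)} =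
        K0.map (Ideal.Quotient.mk I) := by
      rw [Ideal.map_span]
      congr 1
      ext z
      constructor
      · rintro ⟨i, hi, rfl⟩; exact ⟨_, ⟨i, hi, rfl⟩, rfl⟩
      · rintro ⟨_, ⟨i, hi, rfl⟩, rfl⟩; exact ⟨i, hi, rfl⟩
    have hmemK : ∀ s : S, Ideal.Quotient.mk I s ∈ K0.map (Ideal.Quotient.mk I) ↔ s ∈ K := by
      intro s
      rw [← Ideal.mem_comap, Ideal.comap_map_of_surjective' _ Ideal.Quotient.mk_surjective,
        Ideal.mk_ker]
    rw [hspan, hmemK]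
    rw [hspan, ← map_mul, hmemK] at hr
    refine aux_regular ρ ?_ K ?_ (y j) ?_ r hr
    · intro s
      apply Subtype.ext
      rw [hρ2, auxTrans_coeff_zero]
    · have hKle : K ≤ (K.map (Polynomial.C : S →+* Polynomial S)).comap ρ := by
        refine sup_le (Ideal.span_le.2 ?_) (Ideal.span_le.2 ?_)
        · rintro _ ⟨i, hi, rfl⟩
          have : ρ (y i) = Polynomial.C (y i) := by
            apply hinj
            rw [hρ, Polynomial.map_C]
            change auxTrans (b j) (y i : (MvPolynomial (Fin n) k)) = _
            rw [hρy, if_neg hi.ne']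
            simp only [map_zero, zero_mul, add_zero]
            rw [← map_prod]
            rfl
          rw [SetLike.mem_coe, Ideal.mem_comap, this]
          exact Ideal.mem_map_of_mem _ (Ideal.mem_sup_left (Ideal.subset_span ⟨i, hi, rfl⟩))
        · rintro z ⟨Y, hY, f, hf, hz⟩
          rw [SetLike.mem_coe, Ideal.mem_comap, Ideal.mem_map_C_iff]
          intro m
          refine Ideal.mem_sup_right (Ideal.subset_span
            ⟨Y, hY, (auxTrans (b j) f).coeff m, ?_, ?_⟩)
          · intro x
            have h1 := auxTrans_smul hlin (b j) (hv j) (x : G) f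
            rw [hf x] at h1
            have h2 := congrArg (fun q => Polynomial.coeff q m) h1
            simp only [Polynomial.coeff_map] at h2
            exact h2.symm
          · rw [hρ2, hz, aux_trans_transfer hlin (b j) (hv j)]
      exact fun x hx => hKle hx
    · apply Polynomial.monic_of_injective (f := S.subtype) Subtype.val_injective
      rw [hρ]
      change (auxTrans (b j) (y j : (MvPolynomial (Fin n) k))).Monic
      rw [hρy, if_pos rfl]
      refine Polynomial.monic_prod_of_monic _ _ fun σ _ => ?_
      rw [map_one, map_one, one_mul, add_comm]
      exact Polynomial.monic_X_add_C _

end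

/-- Totaro: for a `p`-group `G` in characteristic `p` and
`I = I^G_{<G}` the transfer ideal of the set of all proper subgroups,
`k[V]^G / I` is Cohen–Macaulay of Krull dimension `dim V^G`: its Krull
dimension equals `dim V^G`, and there is a regular sequence of that length
consisting of elements of positive degree. -/
theorem quotient_by_proper_transferIdeal_CohenMacaulay
    (k : Type) [Field k] (p : ℕ) [Fact p.Prime] [CharP k p]
    (G : Type) [Group G] [Fintype G] (hG : IsPGroup p G)
    (n : ℕ)
    [MulSemiringAction G (MvPolynomial (Fin n) k)]
    [SMulCommClass G k (MvPolynomial (Fin n) k)]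
    (hlin : ∀ (σ : G) (i : Fin n), (σ • (X i : MvPolynomial (Fin n) k)).IsHomogeneous 1)
    -- `G` acts linearly on `V = Fin n → k` itself:
    [DistribMulAction G (Fin n → k)] [SMulCommClass G k (Fin n → k)]
    -- compatibility: the action on `k[V]` is dual to the action on `V`,
    -- `(σ·f)(v) = f(σ⁻¹·v)`:
    (hcompat : ∀ (σ : G) (f : MvPolynomial (Fin n) k) (v : Fin n → k),
      eval v (σ • f) = eval (σ⁻¹ • v) f) :
    ringKrullDim ((invSub G (MvPolynomial (Fin n) k) ⊤) ⧸
        transferIdealProper G (MvPolynomial (Fin n) k)) =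
      (Module.finrank k (fixedSubmodule k G (Fin n → k) ⊤) : WithBot (WithTop ℕ)) ∧
    ∃ a : Fin (Module.finrank k (fixedSubmodule k G (Fin n → k) ⊤)) →
        (invSub G (MvPolynomial (Fin n) k) ⊤) ⧸
          transferIdealProper G (MvPolynomial (Fin n) k),
      (∀ i, ∃ f : invSub G (MvPolynomial (Fin n) k) ⊤,
        constantCoeff (f : MvPolynomial (Fin n) k) = 0 ∧
        a i = Ideal.Quotient.mk (transferIdealProper G (MvPolynomial (Fin n) k)) f) ∧
      (∀ j, ∀ r, a j * r ∈ Ideal.span {y | ∃ i, i < j ∧ y = a i} →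
        r ∈ Ideal.span {y | ∃ i, i < j ∧ y = a i}) := by
  classical
  set W := fixedSubmodule k G (Fin n → k) ⊤ with hW
  let bas := Module.finBasis k W
  let b : Fin (Module.finrank k W) → Fin n → k := fun j => (bas j : Fin n → k)
  have hb : ∀ j (σ : G), σ • b j = b j := fun j σ => (bas j).2 ⟨σ, Subgroup.mem_top σ⟩
  have hv : ∀ j (σ : G) i, eval (b j) (σ • (X i : MvPolynomial (Fin n) k)) = b j i := by
    intro j σ i
    rw [hcompat, hb, eval_X]
  -- linear functionals as linear forms
  let Φ : ((Fin n → k) →ₗ[k] k) →ₗ[k] MvPolynomial (Fin n) k :=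
    { toFun := fun φ => ∑ i, C (φ (Pi.single i 1)) * X i
      map_add' := by intro φ ψ; simp [add_mul, Finset.sum_add_distrib]
      map_smul' := by intro c φ; simp [Finset.smul_sum, smul_eq_C_mul, mul_assoc] }
  have hΦ : ∀ φ, Φ φ = ∑ i, C (φ (Pi.single i 1)) * X i := fun _ => rfl
  have hΦhom : ∀ φ, (Φ φ).IsHomogeneous 1 := by
    intro φ
    refine IsHomogeneous.sum _ _ _ fun i _ => ?_
    simpa using (isHomogeneous_C (Fin n) (φ (Pi.single i 1))).mul (isHomogeneous_X k i)
  have hΦev : ∀ φ v, eval v (Φ φ) = φ v := by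
    intro φ v
    rw [hΦ, LinearMap.pi_apply_eq_sum_univ φ v]
    simp only [map_sum, map_mul, eval_C, eval_X, smul_eq_mul]
    refine Finset.sum_congr rfl fun i _ => ?_
    rw [mul_comm]
    congr 2
    funext m
    simp [Pi.single_apply, eq_comm]
  have hΦeq : ∀ (ℓ : MvPolynomial (Fin n) k), ℓ.IsHomogeneous 1 →
      ℓ = ∑ i, C (eval (Pi.single i 1) ℓ) * X i := by
    intro ℓ h
    refine aux_hom_one h (P := fun ℓ => ℓ = ∑ i, C (eval (Pi.single i 1) ℓ) * X i) ?_ ?_ ?_ ?_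
    · intro i
      simp [Pi.single_apply]
    · simp
    · intro u w hu hw
      conv_lhs => rw [hu, hw]
      simp [add_mul, Finset.sum_add_distrib]
    · intro c u hu
      conv_lhs => rw [hu]
      simp [Finset.smul_sum, smul_eq_C_mul, mul_assoc]
  have hφ : ∀ j, ∃ φ : (Fin n → k) →ₗ[k] k, φ.comp W.subtype = bas.coord j :=
    fun j => LinearMap.exists_extend _
  choose φ hφ using hφ
  have hφW : ∀ j (w : W), φ j (w : Fin n → k) = bas.repr w j := by
    intro j w
    exact LinearMap.congr_fun (hφ j) w
  let ℓ : Fin (Module.finrank k W) → MvPolynomial (Fin n) k := fun j => Φ (φ j)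
  have hℓ : ∀ j, (ℓ j).IsHomogeneous 1 := fun j => hΦhom _
  have hℓb : ∀ i j, eval (b i) (ℓ j) = if i = j then 1 else 0 := by
    intro i j
    rw [hΦev, hφW, Module.Basis.repr_self, Finsupp.single_apply]
  have hgen : ∀ i, (X i - ∑ j, C (b j i) * ℓ j : MvPolynomial (Fin n) k) ∈
      Submodule.span k (Set.range fun q : G × Fin n =>
        (q.1 • (X q.2 : MvPolynomial (Fin n) k) - X q.2)) := by
    intro i
    let L : G × Fin n → ((Fin n → k) →ₗ[k] k) := fun q =>
      { toFun := fun v => (q.1⁻¹ • v) q.2 - v q.2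
        map_add' := by intro u w; simp; ring
        map_smul' := by intro c u; rw [smul_comm]; simp [mul_sub] }
    let K : (Fin n → k) →ₗ[k] k := LinearMap.proj i - ∑ j, b j i • φ j
    have hK : K ∈ Submodule.span k (Set.range L) := by
      refine FiniteDimensional.mem_span_of_iInf_ker_le_ker ?_
      intro v hvL
      have hvW : v ∈ W := by
        rintro ⟨g, -⟩
        funext m
        have h1 := (Submodule.mem_iInf _).1 hvL (g⁻¹, m)
        rw [LinearMap.mem_ker] at h1
        change ((g⁻¹)⁻¹ • v) m - v m = 0 at h1
        rw [inv_inv] at h1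
        exact sub_eq_zero.1 h1
      have hsum := congrArg (fun w : W => (w : Fin n → k) i) (bas.sum_repr ⟨v, hvW⟩)
      rw [LinearMap.mem_ker]
      simp only [K, LinearMap.sub_apply, LinearMap.proj_apply, LinearMap.sum_apply,
        LinearMap.smul_apply, smul_eq_mul]
      rw [sub_eq_zero]
      refine hsum.symm.trans ?_
      simp only [Submodule.coe_sum, Submodule.coe_smul, Finset.sum_apply, Pi.smul_apply,
        smul_eq_mul]
      refine Finset.sum_congr rfl fun j _ => ?_
      rw [← hφW j ⟨v, hvW⟩, mul_comm]
    have hL : ∀ q, Φ (L q) = q.1 • (X q.2 : MvPolynomial (Fin n) k) - X q.2 := by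
      intro q
      rw [hΦeq (q.1 • (X q.2 : MvPolynomial (Fin n) k) - X q.2)
        ((hlin q.1 q.2).sub (isHomogeneous_X k q.2)), hΦ]
      refine Finset.sum_congr rfl fun m _ => ?_
      rw [eval_sub, hcompat, eval_X, eval_X]
      rfl
    have hKΦ : Φ K = X i - ∑ j, C (b j i) * ℓ j := by
      simp only [K, map_sub, map_sum, map_smul, smul_eq_C_mul]
      congr 1
      rw [hΦ, hΦeq (X i) (isHomogeneous_X k i)]
      simp
    rw [← hKΦ]
    have h2 := Submodule.mem_map_of_mem (f := Φ) hK
    rw [Submodule.map_span, ← Set.range_comp] at h2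
    have h3 : (Φ ∘ L) = fun q : G × Fin n =>
        (q.1 • (X q.2 : MvPolynomial (Fin n) k) - X q.2) := funext hL
    rwa [h3] at h2
  exact ⟨aux_dim p hG hlin b hv ℓ hℓ hℓb hgen, aux_seq hlin b hv ℓ hℓ hℓb⟩
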